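/- Suppose λ > 0 is a real number and w ∈ L¹(ℝ) satisfies ‖w‖₁ ≤ (π/2)·λ². Then for all f, g ∈ L¹(ℝ) with ‖f‖₁ ≤ π·λ² and ‖g‖₁ ≤ π·λ², one has ‖R[f]‖₁ ≤ (9/10)·π·λ² and ‖R[f] − R[g]‖₁ ≤ (8/10)·‖f − g‖₁; that is, R maps the closed ball of radius πλ² in L¹(ℝ) into itself and is a contraction on that ball. -/

import Mathlib

open MeasureTheory Filter

noncomputable section

/-- The Fourier transform `f̂(ξ) = ∫ exp(−i x ξ) f(x) dx` of a real-valued function. -/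
def FT (f : ℝ → ℝ) (ξ : ℝ) : ℂ :=
  ∫ x : ℝ, Complex.exp (-(Complex.I * (x:ℂ) * (ξ:ℂ))) * (f x : ℂ)

/-- Convolution of two complex-valued functions on `ℝ`. -/
def conv (f g : ℝ → ℂ) (ξ : ℝ) : ℂ := ∫ η : ℝ, f (ξ - η) * g η

/-- `convIter ψ n = ψ^{*(n+1)}`, the `(n+1)`-fold convolution of `ψ` with itself. -/
def convIter (ψ : ℝ → ℂ) : ℕ → ℝ → ℂ
  | 0 => ψ
  | n + 1 => conv (convIter ψ n) ψ

/-- `exp₁*[ψ](ξ) = Σ_{n=1}^∞ ψ^{*n}(ξ)/(n!·(2π)^{n−1})`. -/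
def exp1star (ψ : ℝ → ℂ) (ξ : ℝ) : ℂ :=
  ∑' n : ℕ, convIter ψ n ξ / ((Nat.factorial (n + 1) : ℂ) * ((2 * Real.pi : ℝ) : ℂ) ^ n)

/-- `exp₂*[ψ](ξ) = Σ_{n=2}^∞ ψ^{*n}(ξ)/(n!·(2π)^{n−1})`. -/
def exp2star (ψ : ℝ → ℂ) (ξ : ℝ) : ℂ :=
  ∑' n : ℕ, convIter ψ (n + 1) ξ / ((Nat.factorial (n + 2) : ℂ) * ((2 * Real.pi : ℝ) : ℂ) ^ (n + 1))

/-- `W_b[f](ξ) = f(ξ)·b̂(ξ)/(4λ² − ξ²)`. -/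
def Wb (lam : ℝ) (b : ℝ → ℝ) (f : ℝ → ℂ) (ξ : ℝ) : ℂ :=
  f ξ * ((b ξ : ℝ) : ℂ) / (((4 * lam ^ 2 - ξ ^ 2 : ℝ)) : ℂ)

/-- `W̃_b[f](ξ) = −iξ·f(ξ)·b̂(ξ)/(4λ² − ξ²)`. -/
def Wtb (lam : ℝ) (b : ℝ → ℝ) (f : ℝ → ℂ) (ξ : ℝ) : ℂ :=
  -(Complex.I * (ξ:ℂ)) * f ξ * ((b ξ : ℝ) : ℂ) / (((4 * lam ^ 2 - ξ ^ 2 : ℝ)) : ℂ)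

/-- The nonlinear operator
`R[f](ξ) = (1/(8π))·(W̃_b[f] * W̃_b[f])(ξ) − 4λ²·exp₂*[W_b[f]](ξ) + w(ξ)`. -/
def Rop (lam : ℝ) (b : ℝ → ℝ) (w : ℝ → ℂ) (f : ℝ → ℂ) (ξ : ℝ) : ℂ :=
  ((1 / (8 * Real.pi) : ℝ) : ℂ) * conv (Wtb lam b f) (Wtb lam b f) ξ
    - ((4 * lam ^ 2 : ℝ) : ℂ) * exp2star (Wb lam b f) ξ + w ξ

/-- The nonlinear differential operator `S[f](x) = (f′(x))²/4 − 4λ²·(exp(f(x)) − f(x) − 1)`. -/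
def Sop (lam : ℝ) (f : ℝ → ℂ) (x : ℝ) : ℂ :=
  (deriv f x) ^ 2 / 4 - ((4 * lam ^ 2 : ℝ) : ℂ) * (Complex.exp (f x) - f x - 1)

/-- The operator `T[f](x) = (1/2π)·∫ exp(i x ξ)·f̂(ξ)/(4λ² − ξ²) dξ`. -/
def OpT (lam : ℝ) (f : ℝ → ℝ) (x : ℝ) : ℂ :=
  ((1 / (2 * Real.pi) : ℝ) : ℂ) *
    ∫ ξ : ℝ, Complex.exp (Complex.I * (x:ℂ) * (ξ:ℂ)) * FT f ξ / (((4 * lam ^ 2 - ξ ^ 2 : ℝ)) : ℂ)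

/-- The band-limited operator `T_b[f](x) = (1/2π)·∫ exp(i x ξ)·f̂(ξ)·b̂(ξ)/(4λ² − ξ²) dξ`,
so that `T_b[f]^(ξ) = f̂(ξ)·b̂(ξ)/(4λ² − ξ²)`. -/
def Tb (lam : ℝ) (b : ℝ → ℝ) (f : ℝ → ℝ) (x : ℝ) : ℂ :=
  ((1 / (2 * Real.pi) : ℝ) : ℂ) *
    ∫ ξ : ℝ, Complex.exp (Complex.I * (x:ℂ) * (ξ:ℂ)) * FT f ξ * ((b ξ : ℝ) : ℂ) /
      (((4 * lam ^ 2 - ξ ^ 2 : ℝ)) : ℂ)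

/-- The Schwarzian derivative `{f, x} = f′′′(x)/f′(x) − (3/2)·(f′′(x)/f′(x))²`. -/
def schwarzian (f : ℝ → ℝ) (x : ℝ) : ℝ :=
  deriv (deriv (deriv f)) x / deriv f x - (3 / 2) * (deriv (deriv f) x / deriv f x) ^ 2

/-- A real-valued function is Schwartz if it agrees with an element of the Schwartz space. -/
def IsSchwartz (f : ℝ → ℝ) : Prop := ∃ g : SchwartzMap ℝ ℝ, ∀ x, g x = f x

/-- The `L¹(ℝ)` norm `‖f‖₁ = ∫ |f(ξ)| dξ`. -/
def L1norm (f : ℝ → ℂ) : ℝ := ∫ ξ : ℝ, ‖f ξ‖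

/-- The modified Bessel function of the second kind,
`K_ν(t) = ∫₀^∞ exp(−t·cosh(s))·cosh(νs) ds`. -/
def besselK (ν t : ℝ) : ℝ :=
  ∫ s in Set.Ioi (0 : ℝ), Real.exp (-t * Real.cosh s) * Real.cosh (ν * s)

/-- Kummer's confluent hypergeometric function
`M(a,b,z) = Σ_{n=0}^∞ ((a)_n/(b)_n)·zⁿ/n!` with `(a)_n = Γ(a+n)/Γ(a)`. -/
def kummerM (a b z : ℝ) : ℝ :=
  ∑' n : ℕ, (Real.Gamma (a + n) / Real.Gamma a) / (Real.Gamma (b + n) / Real.Gamma b)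
      * z ^ n / (Nat.factorial n : ℝ)

/-- The standing hypotheses on the bump function `b̂`: it is smooth, compactly supported,
equal to `1` on `[−λ, λ]`, takes values in `[0, 1]`, and is supported inside
`(−√2·λ, √2·λ)`. -/
def BumpHyp (lam : ℝ) (b : ℝ → ℝ) : Prop :=
  ContDiff ℝ (⊤ : ℕ∞) b ∧ HasCompactSupport b ∧
    (∀ ξ : ℝ, |ξ| ≤ lam → b ξ = 1) ∧ (∀ ξ : ℝ, 0 ≤ b ξ ∧ b ξ ≤ 1) ∧
    tsupport b ⊆ Set.Ioo (-(Real.sqrt 2 * lam)) (Real.sqrt 2 * lam)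


lemma L1norm_nonneg (f : ℝ → ℂ) : 0 ≤ L1norm f := integral_nonneg fun _ => norm_nonneg _

lemma L1norm_congr_ae {f g : ℝ → ℂ} (h : f =ᵐ[volume] g) : L1norm f = L1norm g :=
  integral_congr_ae (h.fun_comp norm)

lemma L1norm_add_le {f g : ℝ → ℂ} (hf : Integrable f) (hg : Integrable g) :
    L1norm (fun ξ => f ξ + g ξ) ≤ L1norm f + L1norm g := by
  unfold L1norm
  rw [← integral_add hf.norm hg.norm]
  exact integral_mono (hf.add hg).norm (hf.norm.add hg.norm) fun ξ => norm_add_le _ _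

lemma L1norm_sub_le {f g : ℝ → ℂ} (hf : Integrable f) (hg : Integrable g) :
    L1norm (fun ξ => f ξ - g ξ) ≤ L1norm f + L1norm g := by
  unfold L1norm
  rw [← integral_add hf.norm hg.norm]
  exact integral_mono (hf.sub hg).norm (hf.norm.add hg.norm) fun ξ => norm_sub_le _ _

lemma L1norm_const_mul (c : ℂ) (f : ℝ → ℂ) : L1norm (fun ξ => c * f ξ) = ‖c‖ * L1norm f := by
  simp only [L1norm, norm_mul, integral_const_mul]

lemma L1norm_div_const (c : ℂ) (f : ℝ → ℂ) : L1norm (fun ξ => f ξ / c) = L1norm f / ‖c‖ := by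
  simp only [L1norm, norm_div, integral_div]

lemma conv_eq_convolution (f g : ℝ → ℂ) :
    conv f g = convolution f g (ContinuousLinearMap.mul ℝ ℂ) volume := by
  funext ξ
  exact (convolution_eq_swap (ContinuousLinearMap.mul ℝ ℂ)).symm

lemma integrable_conv {f g : ℝ → ℂ} (hf : Integrable f) (hg : Integrable g) :
    Integrable (conv f g) := by
  rw [conv_eq_convolution]
  exact hf.integrable_convolution _ hg

lemma ae_integrable_conv_integrand {f g : ℝ → ℂ} (hf : Integrable f) (hg : Integrable g) :
    ∀ᵐ ξ, Integrable fun η => f (ξ - η) * g η := by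
  filter_upwards [hf.ae_convolution_exists (ContinuousLinearMap.mul ℝ ℂ) hg] with ξ hξ
  exact hξ.integrable_swap

lemma L1norm_conv_le {f g : ℝ → ℂ} (hf : Integrable f) (hg : Integrable g) :
    L1norm (conv f g) ≤ L1norm f * L1norm g := by
  have hint := hf.norm.integrable_convolution (ContinuousLinearMap.mul ℝ ℝ) hg.norm
  have heq := integral_convolution (ContinuousLinearMap.mul ℝ ℝ) hf.norm hg.norm
  refine (integral_mono (integrable_conv hf hg).norm hint fun ξ => ?_).trans heq.le
  simp only [convolution_eq_swap, ContinuousLinearMap.mul_apply', ← norm_mul]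
  exact norm_integral_le_integral_norm _

lemma conv_sub_conv_ae {f₁ f₂ g₁ g₂ : ℝ → ℂ} (hf₁ : Integrable f₁) (hf₂ : Integrable f₂)
    (hg₁ : Integrable g₁) (hg₂ : Integrable g₂) :
    (fun ξ => conv f₁ g₁ ξ - conv f₂ g₂ ξ) =ᵐ[volume]
      fun ξ => conv (fun η => f₁ η - f₂ η) g₁ ξ + conv f₂ (fun η => g₁ η - g₂ η) ξ := by
  filter_upwards [ae_integrable_conv_integrand hf₁ hg₁, ae_integrable_conv_integrand hf₂ hg₁,
    ae_integrable_conv_integrand hf₂ hg₂] with ξ h₁ h₂ h₃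
  simp only [conv, sub_mul, mul_sub]
  rw [integral_sub h₁ h₂, integral_sub h₂ h₃]
  ring

lemma L1norm_conv_sub_conv_le {f₁ f₂ g₁ g₂ : ℝ → ℂ} (hf₁ : Integrable f₁) (hf₂ : Integrable f₂)
    (hg₁ : Integrable g₁) (hg₂ : Integrable g₂) :
    L1norm (fun ξ => conv f₁ g₁ ξ - conv f₂ g₂ ξ) ≤
      L1norm (fun ξ => f₁ ξ - f₂ ξ) * L1norm g₁ + L1norm f₂ * L1norm (fun ξ => g₁ ξ - g₂ ξ) := by
  rw [L1norm_congr_ae (conv_sub_conv_ae hf₁ hf₂ hg₁ hg₂)]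
  exact (L1norm_add_le (integrable_conv (hf₁.sub hf₂) hg₁)
    (integrable_conv hf₂ (hg₁.sub hg₂))).trans
    (add_le_add (L1norm_conv_le (hf₁.sub hf₂) hg₁) (L1norm_conv_le hf₂ (hg₁.sub hg₂)))

lemma integrable_convIter {ψ : ℝ → ℂ} (hψ : Integrable ψ) (n : ℕ) :
    Integrable (convIter ψ n) := by
  induction n with
  | zero => exact hψ
  | succ n ih => exact integrable_conv ih hψ

lemma L1norm_convIter_le {ψ : ℝ → ℂ} (hψ : Integrable ψ) {X : ℝ} (hX : L1norm ψ ≤ X) (n : ℕ) :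
    L1norm (convIter ψ n) ≤ X ^ (n + 1) := by
  have hX0 := (L1norm_nonneg ψ).trans hX
  induction n with
  | zero => simpa [convIter] using hX
  | succ n ih =>
    rw [pow_succ]
    exact (L1norm_conv_le (integrable_convIter hψ n) hψ).trans
      (mul_le_mul ih hX (L1norm_nonneg _) (by positivity))

lemma L1norm_convIter_sub_le {φ ψ : ℝ → ℂ} (hφ : Integrable φ) (hψ : Integrable ψ) {X : ℝ}
    (hφX : L1norm φ ≤ X) (hψX : L1norm ψ ≤ X) (n : ℕ) :
    L1norm (fun ξ => convIter φ n ξ - convIter ψ n ξ) ≤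
      (n + 1) * X ^ n * L1norm (fun ξ => φ ξ - ψ ξ) := by
  have hX0 := (L1norm_nonneg ψ).trans hψX
  have hd := L1norm_nonneg fun ξ => φ ξ - ψ ξ
  induction n with
  | zero => simp [convIter]
  | succ n ih =>
    refine (L1norm_conv_sub_conv_le (integrable_convIter hφ n) (integrable_convIter hψ n)
      hφ hψ).trans ?_
    calc _ ≤ ((n + 1) * X ^ n * L1norm (fun ξ => φ ξ - ψ ξ)) * X
          + X ^ (n + 1) * L1norm (fun ξ => φ ξ - ψ ξ) := by
          gcongr
          · exact L1norm_nonneg _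
          · exact L1norm_convIter_le hψ hψX n
      _ = _ := by push_cast; ring

lemma ofReal_L1norm {f : ℝ → ℂ} (hf : Integrable f) :
    ENNReal.ofReal (L1norm f) = ∫⁻ ξ, ‖f ξ‖ₑ :=
  ofReal_integral_norm_eq_lintegral_enorm hf

/-- A series of integrable functions whose `L¹` norms are dominated by a convergent series
converges absolutely almost everywhere, to an integrable function. -/
lemma tsum_of_L1norm_le {F : ℕ → ℝ → ℂ} {c : ℕ → ℝ} {S : ℝ} (hF : ∀ n, Integrable (F n))
    (hc : ∀ n, L1norm (F n) ≤ c n) (hS : HasSum c S) :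
    (∀ᵐ ξ, Summable fun n => F n ξ) ∧ Integrable (fun ξ => ∑' n, F n ξ) ∧
      L1norm (fun ξ => ∑' n, F n ξ) ≤ S := by
  have hc0 n : 0 ≤ c n := (L1norm_nonneg _).trans (hc n)
  have hbound : ∫⁻ ξ, ∑' n, ‖F n ξ‖ₑ ≤ ENNReal.ofReal S := by
    rw [lintegral_tsum fun n => (hF n).1.enorm, ← hS.tsum_eq,
      ENNReal.ofReal_tsum_of_nonneg hc0 hS.summable]
    refine ENNReal.tsum_le_tsum fun n => ?_
    rw [← ofReal_L1norm (hF n)]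
    exact ENNReal.ofReal_le_ofReal (hc n)
  have hsum : ∀ᵐ ξ, Summable fun n => F n ξ := by
    filter_upwards [ae_lt_top' (AEMeasurable.tsum fun n => (hF n).1.enorm)
      (hbound.trans_lt ENNReal.ofReal_lt_top).ne] with ξ hξ
    exact Summable.of_norm (tsum_enorm_ne_top_iff_summable_norm.1 hξ.ne)
  have hmeas : AEStronglyMeasurable (fun ξ => ∑' n, F n ξ) volume := by
    refine aestronglyMeasurable_of_tendsto_ae atTop
      (f := fun N ξ => ∑ n ∈ Finset.range N, F n ξ)
      (fun N => (integrable_finsetSum _ fun n _ => hF n).1) ?_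
    filter_upwards [hsum] with ξ hξ
    exact hξ.hasSum.tendsto_sum_nat
  have hle : ∫⁻ ξ, ‖∑' n, F n ξ‖ₑ ≤ ENNReal.ofReal S :=
    (lintegral_mono fun ξ => enorm_tsum_le_tsum_enorm).trans hbound
  have hint : Integrable (fun ξ => ∑' n, F n ξ) :=
    ⟨hmeas, hle.trans_lt ENNReal.ofReal_lt_top⟩
  refine ⟨hsum, hint, ?_⟩
  rw [← ofReal_L1norm hint] at hle
  exact (ENNReal.ofReal_le_ofReal_iff (hS.nonneg hc0)).1 hle

lemma hasSum_exp_tail_one (t : ℝ) :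
    HasSum (fun n : ℕ => t ^ (n + 1) / (Nat.factorial (n + 1) : ℝ)) (Real.exp t - 1) := by
  have h := (hasSum_nat_add_iff' 1).2 (NormedSpace.expSeries_div_hasSum_exp t)
  simpa [← Real.exp_eq_exp_ℝ] using h

lemma hasSum_exp_tail_two (t : ℝ) :
    HasSum (fun n : ℕ => t ^ (n + 2) / (Nat.factorial (n + 2) : ℝ)) (Real.exp t - 1 - t) := by
  have h := (hasSum_nat_add_iff' 2).2 (NormedSpace.expSeries_div_hasSum_exp t)
  simpa [← Real.exp_eq_exp_ℝ, Finset.sum_range_succ, sub_sub] using h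

lemma norm_factorial_mul_two_pi_pow (n : ℕ) :
    ‖(Nat.factorial (n + 2) : ℂ) * ((2 * Real.pi : ℝ) : ℂ) ^ (n + 1)‖ =
      (Nat.factorial (n + 2) : ℝ) * (2 * Real.pi) ^ (n + 1) := by
  rw [norm_mul, norm_pow, Complex.norm_natCast, Complex.norm_real,
    Real.norm_of_nonneg (by positivity)]

lemma exp2star_bounds {ψ : ℝ → ℂ} (hψ : Integrable ψ) {X : ℝ} (hX : L1norm ψ ≤ X) :
    (∀ᵐ ξ, Summable fun n : ℕ => convIter ψ (n + 1) ξ /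
      ((Nat.factorial (n + 2) : ℂ) * ((2 * Real.pi : ℝ) : ℂ) ^ (n + 1))) ∧
    Integrable (exp2star ψ) ∧
    L1norm (exp2star ψ) ≤
      2 * Real.pi * (Real.exp (X / (2 * Real.pi)) - 1 - X / (2 * Real.pi)) := by
  refine tsum_of_L1norm_le (fun n => (integrable_convIter hψ (n + 1)).div_const _) (fun n => ?_)
    ((hasSum_exp_tail_two (X / (2 * Real.pi))).mul_left (2 * Real.pi))
  rw [L1norm_div_const, norm_factorial_mul_two_pi_pow]
  have hpi := Real.pi_pos
  calc _ ≤ X ^ (n + 2) / ((Nat.factorial (n + 2) : ℝ) * (2 * Real.pi) ^ (n + 1)) := by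
        gcongr
        exact L1norm_convIter_le hψ hX (n + 1)
    _ = _ := by rw [div_pow, pow_succ (2 * Real.pi) (n + 1)]; field_simp

lemma L1norm_exp2star_sub_le {φ ψ : ℝ → ℂ} (hφ : Integrable φ) (hψ : Integrable ψ) {X : ℝ}
    (hφX : L1norm φ ≤ X) (hψX : L1norm ψ ≤ X) :
    L1norm (fun ξ => exp2star φ ξ - exp2star ψ ξ) ≤
      L1norm (fun ξ => φ ξ - ψ ξ) * (Real.exp (X / (2 * Real.pi)) - 1) := by
  have hae : (fun ξ => exp2star φ ξ - exp2star ψ ξ) =ᵐ[volume] fun ξ =>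
      ∑' n : ℕ, (convIter φ (n + 1) ξ - convIter ψ (n + 1) ξ) /
        ((Nat.factorial (n + 2) : ℂ) * ((2 * Real.pi : ℝ) : ℂ) ^ (n + 1)) := by
    filter_upwards [(exp2star_bounds hφ hφX).1, (exp2star_bounds hψ hψX).1] with ξ h₁ h₂
    simp only [exp2star, sub_div]
    exact (h₁.tsum_sub h₂).symm
  rw [L1norm_congr_ae hae]
  refine (tsum_of_L1norm_le (fun n => ((integrable_convIter hφ (n + 1)).sub
    (integrable_convIter hψ (n + 1))).div_const _) (fun n => ?_)
    ((hasSum_exp_tail_one (X / (2 * Real.pi))).mul_left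
      (L1norm fun ξ => φ ξ - ψ ξ))).2.2
  refine (L1norm_div_const _ fun ξ => convIter φ (n + 1) ξ - convIter ψ (n + 1) ξ).trans_le ?_
  rw [norm_factorial_mul_two_pi_pow]
  have hpi := Real.pi_pos
  have h := L1norm_convIter_sub_le hφ hψ hφX hψX (n + 1)
  calc _ ≤ ((n + 1 : ℕ) + 1) * X ^ (n + 1) * L1norm (fun ξ => φ ξ - ψ ξ) /
        ((Nat.factorial (n + 2) : ℝ) * (2 * Real.pi) ^ (n + 1)) := by gcongr
    _ = _ := by
      rw [div_pow, Nat.factorial_succ (n + 1)]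
      push_cast
      have : (n : ℝ) + 1 + 1 ≠ 0 := by positivity
      field_simp

/-- Multiplication by a bounded measurable function, with a bound on the `L¹` norm. -/
lemma integrable_mul_bounded {m f : ℝ → ℂ} {C : ℝ} (hm : AEStronglyMeasurable m volume)
    (hC : ∀ ξ, ‖m ξ‖ ≤ C) (hf : Integrable f) :
    Integrable (fun ξ => m ξ * f ξ) ∧ L1norm (fun ξ => m ξ * f ξ) ≤ C * L1norm f := by
  have hint : Integrable (fun ξ => m ξ * f ξ) := hf.bdd_mul hm (Eventually.of_forall hC)
  refine ⟨hint, ?_⟩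
  unfold L1norm
  rw [← integral_const_mul]
  refine integral_mono hint.norm (hf.norm.const_mul C) fun ξ => ?_
  simp only [norm_mul]
  exact mul_le_mul_of_nonneg_right (hC ξ) (norm_nonneg _)

lemma BumpHyp.eq_zero {lam : ℝ} {b : ℝ → ℝ} (hb : BumpHyp lam b) {ξ : ℝ}
    (hξ : 2 * lam ^ 2 ≤ ξ ^ 2) : b ξ = 0 := by
  by_contra h
  obtain ⟨h₁, h₂⟩ := hb.2.2.2.2 (subset_tsupport b h)
  have hs : (√2 * lam) ^ 2 = 2 * lam ^ 2 := by rw [mul_pow, Real.sq_sqrt (by norm_num)]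
  have := sq_lt_sq' h₁ h₂
  linarith

lemma norm_Wb_multiplier_le {lam : ℝ} (hlam : 0 < lam) {b : ℝ → ℝ} (hb : BumpHyp lam b) (ξ : ℝ) :
    ‖(b ξ : ℂ) / ((4 * lam ^ 2 - ξ ^ 2 : ℝ) : ℂ)‖ ≤ 1 / (2 * lam ^ 2) := by
  rcases le_or_gt (2 * lam ^ 2) (ξ ^ 2) with h | h
  · rw [hb.eq_zero h]
    simp only [Complex.ofReal_zero, zero_div, norm_zero]
    positivity
  · obtain ⟨h0, h1⟩ := hb.2.2.2.1 ξ
    have hpos : 0 < lam ^ 2 := by positivity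
    rw [norm_div, Complex.norm_real, Complex.norm_real, Real.norm_of_nonneg h0,
      Real.norm_of_nonneg (by linarith)]
    exact div_le_div₀ zero_le_one h1 (by linarith) (by linarith)

lemma norm_Wtb_multiplier_le {lam : ℝ} (hlam : 0 < lam) {b : ℝ → ℝ} (hb : BumpHyp lam b)
    (ξ : ℝ) :
    ‖-(Complex.I * (ξ : ℂ)) * ((b ξ : ℂ) / ((4 * lam ^ 2 - ξ ^ 2 : ℝ) : ℂ))‖ ≤
      1 / (√2 * lam) := by
  have hs : (√2 * lam) ^ 2 = 2 * lam ^ 2 := by rw [mul_pow, Real.sq_sqrt (by norm_num)]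
  rcases le_or_gt (2 * lam ^ 2) (ξ ^ 2) with h | h
  · rw [hb.eq_zero h]
    simp only [Complex.ofReal_zero, zero_div, mul_zero, norm_zero]
    positivity
  · have hξ : |ξ| ≤ √2 * lam := abs_le_of_sq_le_sq (by linarith) (by positivity)
    rw [norm_mul, norm_neg, norm_mul, Complex.norm_I, one_mul, Complex.norm_real, Real.norm_eq_abs]
    calc _ ≤ (√2 * lam) * (1 / (2 * lam ^ 2)) :=
          mul_le_mul hξ (norm_Wb_multiplier_le hlam hb ξ) (norm_nonneg _) (by positivity)
      _ = _ := by rw [← hs]; field_simp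

lemma Wb_eq_mul (lam : ℝ) (b : ℝ → ℝ) (f : ℝ → ℂ) :
    Wb lam b f = fun ξ => ((b ξ : ℂ) / ((4 * lam ^ 2 - ξ ^ 2 : ℝ) : ℂ)) * f ξ := by
  funext ξ
  simp only [Wb]
  ring

lemma Wtb_eq_mul (lam : ℝ) (b : ℝ → ℝ) (f : ℝ → ℂ) :
    Wtb lam b f = fun ξ : ℝ =>
      (-(Complex.I * (ξ : ℂ)) * ((b ξ : ℂ) / ((4 * lam ^ 2 - ξ ^ 2 : ℝ) : ℂ))) * f ξ := by
  funext ξ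
  simp only [Wtb]
  ring

lemma Wb_sub (lam : ℝ) (b : ℝ → ℝ) (f g : ℝ → ℂ) :
    (fun ξ => Wb lam b f ξ - Wb lam b g ξ) = Wb lam b fun ξ => f ξ - g ξ := by
  funext ξ
  simp only [Wb]
  ring

lemma Wtb_sub (lam : ℝ) (b : ℝ → ℝ) (f g : ℝ → ℂ) :
    (fun ξ => Wtb lam b f ξ - Wtb lam b g ξ) = Wtb lam b fun ξ => f ξ - g ξ := by
  funext ξ
  simp only [Wtb]
  ring

lemma Wb_bounds {lam : ℝ} (hlam : 0 < lam) {b : ℝ → ℝ} (hb : BumpHyp lam b) {f : ℝ → ℂ}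
    (hf : Integrable f) :
    Integrable (Wb lam b f) ∧ L1norm (Wb lam b f) ≤ 1 / (2 * lam ^ 2) * L1norm f := by
  have hbm : Measurable b := hb.1.continuous.measurable
  rw [Wb_eq_mul]
  exact integrable_mul_bounded (Measurable.aestronglyMeasurable (by fun_prop)) (norm_Wb_multiplier_le hlam hb) hf

lemma Wtb_bounds {lam : ℝ} (hlam : 0 < lam) {b : ℝ → ℝ} (hb : BumpHyp lam b) {f : ℝ → ℂ}
    (hf : Integrable f) :
    Integrable (Wtb lam b f) ∧ L1norm (Wtb lam b f) ≤ 1 / (√2 * lam) * L1norm f := by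
  have hbm : Measurable b := hb.1.continuous.measurable
  rw [Wtb_eq_mul]
  exact integrable_mul_bounded (Measurable.aestronglyMeasurable (by fun_prop)) (norm_Wtb_multiplier_le hlam hb) hf

lemma exp_quarter_le : Real.exp (1 / 4) ≤ 1.29 := by
  have h : Real.exp (1 / 4) ^ 4 = Real.exp 1 := by
    rw [← Real.exp_nat_mul]
    norm_num
  have h1 := Real.exp_one_lt_d9
  refine le_of_pow_le_pow_left₀ (n := 4) (by norm_num) (by norm_num) ?_
  rw [h]
  norm_num at h1 ⊢
  linarith

lemma L1norm_Wb_le {lam : ℝ} (hlam : 0 < lam) {b : ℝ → ℝ} (hb : BumpHyp lam b) {f : ℝ → ℂ}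
    (hf : Integrable f) (hfn : L1norm f ≤ Real.pi * lam ^ 2) :
    L1norm (Wb lam b f) ≤ Real.pi / 2 := by
  calc _ ≤ 1 / (2 * lam ^ 2) * (Real.pi * lam ^ 2) :=
        (Wb_bounds hlam hb hf).2.trans (by gcongr)
    _ = _ := by field_simp

lemma L1norm_Wtb_conv_sub_le {lam : ℝ} (hlam : 0 < lam) {b : ℝ → ℝ} (hb : BumpHyp lam b)
    {f g : ℝ → ℂ} (hf : Integrable f) (hg : Integrable g) :
    L1norm (fun ξ => conv (Wtb lam b f) (Wtb lam b f) ξ - conv (Wtb lam b g) (Wtb lam b g) ξ) ≤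
      1 / (2 * lam ^ 2) * (L1norm f + L1norm g) * L1norm (fun ξ => f ξ - g ξ) := by
  obtain ⟨hf₁, hf₂⟩ := Wtb_bounds hlam hb hf
  obtain ⟨hg₁, hg₂⟩ := Wtb_bounds hlam hb hg
  have hd := (Wtb_bounds hlam hb (hf.sub hg)).2
  have hs : (√2 * lam) ^ 2 = 2 * lam ^ 2 := by rw [mul_pow, Real.sq_sqrt (by norm_num)]
  refine (L1norm_conv_sub_conv_le hf₁ hg₁ hf₁ hg₁).trans ?_
  rw [Wtb_sub]
  have h0 := L1norm_nonneg f
  have h1 := L1norm_nonneg g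
  have h2 := L1norm_nonneg fun ξ => f ξ - g ξ
  calc _ ≤ (1 / (√2 * lam) * L1norm (fun ξ => f ξ - g ξ)) * (1 / (√2 * lam) * L1norm f)
        + (1 / (√2 * lam) * L1norm g) * (1 / (√2 * lam) * L1norm (fun ξ => f ξ - g ξ)) :=
        add_le_add (mul_le_mul hd hf₂ (L1norm_nonneg _) (by positivity))
          (mul_le_mul hg₂ hd (L1norm_nonneg _) (by positivity))
    _ = _ := by rw [← hs]; ring

lemma half_pi_div_two_pi : Real.pi / 2 / (2 * Real.pi) = 1 / 4 := by
  have := Real.pi_ne_zero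
  field_simp
  norm_num

lemma L1norm_Rop_le {lam : ℝ} (hlam : 0 < lam) {b : ℝ → ℝ} (hb : BumpHyp lam b) {w f : ℝ → ℂ}
    (hw : Integrable w) (hwn : L1norm w ≤ (Real.pi / 2) * lam ^ 2) (hf : Integrable f)
    (hfn : L1norm f ≤ Real.pi * lam ^ 2) :
    L1norm (Rop lam b w f) ≤ (9 / 10) * (Real.pi * lam ^ 2) := by
  have hpi := Real.pi_pos
  obtain ⟨ht₁, ht₂⟩ := Wtb_bounds hlam hb hf
  have hs : (√2 * lam) ^ 2 = 2 * lam ^ 2 := by rw [mul_pow, Real.sq_sqrt (by norm_num)]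
  have hconv : L1norm (conv (Wtb lam b f) (Wtb lam b f)) ≤ Real.pi ^ 2 * lam ^ 2 / 2 := by
    have h : L1norm (Wtb lam b f) ≤ 1 / (√2 * lam) * (Real.pi * lam ^ 2) :=
      ht₂.trans (by gcongr)
    calc _ ≤ (1 / (√2 * lam) * (Real.pi * lam ^ 2)) * (1 / (√2 * lam) * (Real.pi * lam ^ 2)) :=
          (L1norm_conv_le ht₁ ht₁).trans (mul_le_mul h h (L1norm_nonneg _) (by positivity))
      _ = 1 / (√2 * lam) ^ 2 * (Real.pi * lam ^ 2) ^ 2 := by ring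
      _ = _ := by rw [hs]; field_simp
  obtain ⟨-, hE, hEn⟩ := exp2star_bounds (Wb_bounds hlam hb hf).1 (L1norm_Wb_le hlam hb hf hfn)
  rw [half_pi_div_two_pi] at hEn
  have hE₂ : L1norm (exp2star (Wb lam b f)) ≤ 2 * Real.pi * 0.04 :=
    hEn.trans (by gcongr; linarith [exp_quarter_le])
  have hA := (integrable_conv ht₁ ht₁).const_mul ((1 / (8 * Real.pi) : ℝ) : ℂ)
  have hB := hE.const_mul ((4 * lam ^ 2 : ℝ) : ℂ)
  have key := L1norm_add_le (hA.sub hB) hw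
  have key₂ := L1norm_sub_le hA hB
  rw [L1norm_const_mul, L1norm_const_mul, Complex.norm_real, Complex.norm_real,
    Real.norm_of_nonneg (by positivity), Real.norm_of_nonneg (by positivity)] at key₂
  calc L1norm (Rop lam b w f)
      ≤ (1 / (8 * Real.pi) * L1norm (conv (Wtb lam b f) (Wtb lam b f))
        + 4 * lam ^ 2 * L1norm (exp2star (Wb lam b f))) + L1norm w :=
        key.trans (add_le_add_left key₂ _)
    _ ≤ (1 / (8 * Real.pi) * (Real.pi ^ 2 * lam ^ 2 / 2)
        + 4 * lam ^ 2 * (2 * Real.pi * 0.04)) + (Real.pi / 2) * lam ^ 2 := by gcongr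
    _ = (1 / 16 + 0.32 + 1 / 2) * (Real.pi * lam ^ 2) := by field_simp; ring
    _ ≤ _ := by gcongr; norm_num

lemma L1norm_Rop_sub_le {lam : ℝ} (hlam : 0 < lam) {b : ℝ → ℝ} (hb : BumpHyp lam b)
    {w f g : ℝ → ℂ} (hf : Integrable f) (hg : Integrable g)
    (hfn : L1norm f ≤ Real.pi * lam ^ 2) (hgn : L1norm g ≤ Real.pi * lam ^ 2) :
    L1norm (fun ξ => Rop lam b w f ξ - Rop lam b w g ξ) ≤
      (8 / 10) * L1norm (fun ξ => f ξ - g ξ) := by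
  have hpi := Real.pi_pos
  have hd := L1norm_nonneg fun ξ => f ξ - g ξ
  have hf₁ := (Wtb_bounds hlam hb hf).1
  have hg₁ := (Wtb_bounds hlam hb hg).1
  have hf₂ := (Wb_bounds hlam hb hf).1
  have hg₂ := (Wb_bounds hlam hb hg).1
  have hfX := L1norm_Wb_le hlam hb hf hfn
  have hgX := L1norm_Wb_le hlam hb hg hgn
  have hE := L1norm_exp2star_sub_le hf₂ hg₂ hfX hgX
  rw [half_pi_div_two_pi, Wb_sub] at hE
  have hE₂ : L1norm (fun ξ => exp2star (Wb lam b f) ξ - exp2star (Wb lam b g) ξ) ≤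
      (1 / (2 * lam ^ 2) * L1norm (fun ξ => f ξ - g ξ)) * 0.29 :=
    hE.trans (mul_le_mul (Wb_bounds hlam hb (hf.sub hg)).2 (by linarith [exp_quarter_le])
      (by linarith [Real.add_one_le_exp (1 / 4)]) (by positivity))
  have hC : L1norm (fun ξ => conv (Wtb lam b f) (Wtb lam b f) ξ -
      conv (Wtb lam b g) (Wtb lam b g) ξ) ≤
      1 / (2 * lam ^ 2) * (Real.pi * lam ^ 2 + Real.pi * lam ^ 2) *
        L1norm (fun ξ => f ξ - g ξ) :=
    (L1norm_Wtb_conv_sub_le hlam hb hf hg).trans (by gcongr)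
  have hA := ((integrable_conv hf₁ hf₁).sub (integrable_conv hg₁ hg₁)).const_mul
    ((1 / (8 * Real.pi) : ℝ) : ℂ)
  have hB := ((exp2star_bounds hf₂ hfX).2.1.sub (exp2star_bounds hg₂ hgX).2.1).const_mul
    ((4 * lam ^ 2 : ℝ) : ℂ)
  have key := L1norm_sub_le hA hB
  rw [L1norm_const_mul, L1norm_const_mul, Complex.norm_real, Complex.norm_real,
    Real.norm_of_nonneg (by positivity), Real.norm_of_nonneg (by positivity)] at key
  have heq : (fun ξ => Rop lam b w f ξ - Rop lam b w g ξ) = fun ξ =>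
      ((1 / (8 * Real.pi) : ℝ) : ℂ) * (conv (Wtb lam b f) (Wtb lam b f) ξ -
        conv (Wtb lam b g) (Wtb lam b g) ξ) -
      ((4 * lam ^ 2 : ℝ) : ℂ) * (exp2star (Wb lam b f) ξ - exp2star (Wb lam b g) ξ) := by
    funext ξ
    simp only [Rop]
    ring
  rw [heq]
  calc _ ≤ 1 / (8 * Real.pi) * (1 / (2 * lam ^ 2) * (Real.pi * lam ^ 2 + Real.pi * lam ^ 2) *
          L1norm (fun ξ => f ξ - g ξ)) +
        4 * lam ^ 2 * ((1 / (2 * lam ^ 2) * L1norm (fun ξ => f ξ - g ξ)) * 0.29) :=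
        key.trans (add_le_add (mul_le_mul_of_nonneg_left hC (by positivity))
          (mul_le_mul_of_nonneg_left hE₂ (by positivity)))
    _ = (1 / 8 + 0.58) * L1norm (fun ξ => f ξ - g ξ) := by field_simp; ring
    _ ≤ _ := by gcongr; norm_num

/-- from the proof of Theorem `convergence:theorem1`: the operator
`R` maps the closed ball of radius `πλ²` in `L¹(ℝ)` into itself and is a contraction
on that ball. -/
theorem stmt_19
    (lam : ℝ) (hlam : 0 < lam)
    (b : ℝ → ℝ) (hb : BumpHyp lam b)
    (w : ℝ → ℂ) (hw_int : Integrable w)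
    (hw_norm : L1norm w ≤ (Real.pi / 2) * lam ^ 2) :
    ∀ f g : ℝ → ℂ, Integrable f → Integrable g →
      L1norm f ≤ Real.pi * lam ^ 2 → L1norm g ≤ Real.pi * lam ^ 2 →
      L1norm (Rop lam b w f) ≤ (9 / 10) * (Real.pi * lam ^ 2) ∧
      L1norm (fun ξ : ℝ => Rop lam b w f ξ - Rop lam b w g ξ) ≤
        (8 / 10) * L1norm (fun ξ : ℝ => f ξ - g ξ) := by
  intro f g hf hg hfn hgn
  exact ⟨L1norm_Rop_le hlam hb hw_int hw_norm hf hfn, L1norm_Rop_sub_le hlam hb hf hg hfn hgn⟩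

end
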